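/- Let λ be a Lévy measure on (0,∞) and consider I = ∫_0^t ∫_{ℝ^d} ∫_{(0,1]} min(1, g(s,y)² z²) λ(dz) dy ds. If d = 1 then I < ∞ always; if d = 2 then I < ∞ if and only if ∫_{(0,1]} z² |log z| λ(dz) < ∞; if d ≥ 3 then I < ∞ if and only if ∫_{(0,1]} z^{1+2/d} λ(dz) < ∞. -/

import Mathlib

open MeasureTheory Real Filter Set
open scoped ENNReal Topology

noncomputable section

/-- The heat kernel on `ℝ^d` with diffusion constant `κ`. -/
def heatKernel (d : ℕ) (κ : ℝ) (s : ℝ) (x : EuclideanSpace ℝ (Fin d)) : ℝ :=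
  (2 * π * κ * s) ^ (-(d : ℝ) / 2) * Real.exp (-‖x‖ ^ 2 / (2 * κ * s))

/-- A Lévy measure on `(0,∞)`: a nonzero Borel measure carried by `(0,∞)`
with `∫ min(1, z²) λ(dz) < ∞`. -/
def IsLevyMeasure (lam : Measure ℝ) : Prop :=
  lam ≠ 0 ∧ lam (Set.Iic 0) = 0 ∧
    ∫⁻ z in Set.Ioi (0 : ℝ), ENNReal.ofReal (min 1 (z ^ 2)) ∂lam < ⊤

/-- `η̄(r) = (Leb ⊗ Leb ⊗ λ)({(s,y,z) ∈ (0,t] × ℝ^d × (0,∞) : g(s,y) z > r})`. -/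
def etaBar (d : ℕ) (κ t : ℝ) (lam : Measure ℝ) (r : ℝ) : ℝ≥0∞ :=
  (volume.prod (volume.prod lam))
    {p : ℝ × (EuclideanSpace ℝ (Fin d)) × ℝ |
      p.1 ∈ Set.Ioc (0 : ℝ) t ∧ p.2.2 ∈ Set.Ioi (0 : ℝ) ∧
        r < heatKernel d κ p.1 p.2.1 * p.2.2}

/-- `η̄₀(r)`, the analogue of `η̄` with the restriction `|y| ≤ 1/2`. -/
def etaBar0 (d : ℕ) (κ t : ℝ) (lam : Measure ℝ) (r : ℝ) : ℝ≥0∞ :=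
  (volume.prod (volume.prod lam))
    {p : ℝ × (EuclideanSpace ℝ (Fin d)) × ℝ |
      p.1 ∈ Set.Ioc (0 : ℝ) t ∧ p.2.2 ∈ Set.Ioi (0 : ℝ) ∧ ‖p.2.1‖ ≤ 1 / 2 ∧
        r < heatKernel d κ p.1 p.2.1 * p.2.2}

/-- `η̄_A(r)`, where the heat kernel is evaluated at `dist(y, A)`. -/
def etaBarA (d : ℕ) (κ t : ℝ) (lam : Measure ℝ)
    (A : Set (EuclideanSpace ℝ (Fin d))) (r : ℝ) : ℝ≥0∞ :=
  (volume.prod (volume.prod lam))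
    {p : ℝ × (EuclideanSpace ℝ (Fin d)) × ℝ |
      p.1 ∈ Set.Ioc (0 : ℝ) t ∧ p.2.2 ∈ Set.Ioi (0 : ℝ) ∧
        r < (2 * π * κ * p.1) ^ (-(d : ℝ) / 2) *
            Real.exp (-(Metric.infDist p.2.1 A) ^ 2 / (2 * κ * p.1)) * p.2.2}

/-- `τ̄(r) = (Leb ⊗ λ)({(s,z) ∈ (0,t] × (0,∞) : (2πκs)^{-d/2} z > r})`. -/
def tauBar (d : ℕ) (κ t : ℝ) (lam : Measure ℝ) (r : ℝ) : ℝ≥0∞ :=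
  (volume.prod lam)
    {p : ℝ × ℝ | p.1 ∈ Set.Ioc (0 : ℝ) t ∧ p.2 ∈ Set.Ioi (0 : ℝ) ∧
      r < (2 * π * κ * p.1) ^ (-(d : ℝ) / 2) * p.2}

/-- The truncated moment `M_γ(x) = ∫_{(0,x]} z^γ λ(dz)`. -/
def Mgamma (lam : Measure ℝ) (γ x : ℝ) : ℝ≥0∞ :=
  ∫⁻ z in Set.Ioc (0 : ℝ) x, ENNReal.ofReal (z ^ γ) ∂lam

/-- A measurable function, positive on `[1,∞)`, is slowly varying at infinity if
`ℓ(cx)/ℓ(x) → 1` as `x → ∞` for every `c > 0`. -/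
def SlowlyVarying (ℓ : ℝ → ℝ) : Prop :=
  Measurable ℓ ∧ (∀ x ≥ (1 : ℝ), 0 < ℓ x) ∧
    ∀ c > (0 : ℝ), Tendsto (fun x => ℓ (c * x) / ℓ x) atTop (𝓝 1)

/-- Regular variation at infinity with index `-α`: `f` is eventually positive and
`f(cr)/f(r) → c^{-α}` as `r → ∞` for every `c > 0`. -/
def RegVaryNeg (f : ℝ → ℝ) (α : ℝ) : Prop :=
  (∀ᶠ r in atTop, 0 < f r) ∧
    ∀ c > (0 : ℝ), Tendsto (fun r => f (c * r) / f r) atTop (𝓝 (c ^ (-α)))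

/-- Condition (E): the necessary and sufficient condition for existence of the solution. -/
def ConditionE (d : ℕ) (lam : Measure ℝ) : Prop :=
  (∫⁻ z in Set.Ioi (1 : ℝ), ENNReal.ofReal (Real.log z ^ ((d : ℝ) / 2)) ∂lam < ⊤) ∧
  (d = 1 → ∫⁻ z in Set.Ioc (0 : ℝ) 1, ENNReal.ofReal (z ^ 2) ∂lam < ⊤) ∧
  (d = 2 → ∫⁻ z in Set.Ioc (0 : ℝ) 1, ENNReal.ofReal (z ^ 2 * |Real.log z|) ∂lam < ⊤) ∧
  (3 ≤ d → ∫⁻ z in Set.Ioc (0 : ℝ) 1, ENNReal.ofReal (z ^ (1 + 2 / (d : ℝ))) ∂lam < ⊤)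

/-- Condition (F): `∫_{(0,1)} z^{2/d} λ(dz) < ∞` if `d ≠ 2`,
and `∫_{(0,1)} z |log z| λ(dz) < ∞` if `d = 2`. -/
def ConditionF (d : ℕ) (lam : Measure ℝ) : Prop :=
  (d ≠ 2 → ∫⁻ z in Set.Ioo (0 : ℝ) 1, ENNReal.ofReal (z ^ ((2 : ℝ) / d)) ∂lam < ⊤) ∧
  (d = 2 → ∫⁻ z in Set.Ioo (0 : ℝ) 1, ENNReal.ofReal (z * |Real.log z|) ∂lam < ⊤)

lemma lintegral_exp_neg_mul_sq_norm (d : ℕ) {b : ℝ} (hb : 0 < b) :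
    ∫⁻ y : EuclideanSpace ℝ (Fin d), ENNReal.ofReal (rexp (-b * ‖y‖ ^ 2)) =
      ENNReal.ofReal ((π / b) ^ ((d : ℝ) / 2)) := by
  have h := GaussianFourier.integral_rexp_neg_mul_sq_norm (V := EuclideanSpace ℝ (Fin d)) hb
  rw [finrank_euclideanSpace_fin] at h
  rw [← h, ofReal_integral_eq_lintegral_ofReal
    (.of_integral_ne_zero (by rw [h]; positivity)) (ae_of_all _ fun _ => (exp_pos _).le)]

lemma heatKernel_nonneg (d : ℕ) {κ s : ℝ} (hκ : 0 < κ) (hs : 0 < s)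
    (y : EuclideanSpace ℝ (Fin d)) : 0 ≤ heatKernel d κ s y := by
  unfold heatKernel; positivity

lemma heatKernel_le (d : ℕ) {κ s : ℝ} (hκ : 0 < κ) (hs : 0 < s)
    (y : EuclideanSpace ℝ (Fin d)) :
    heatKernel d κ s y ≤ (2 * π * κ * s) ^ (-(d : ℝ) / 2) := by
  refine mul_le_of_le_one_right (by positivity) (exp_le_one_iff.2 ?_)
  rw [neg_div, neg_nonpos]
  positivity

lemma measurable_heatKernel (d : ℕ) (κ : ℝ) :
    Measurable fun p : ℝ × EuclideanSpace ℝ (Fin d) => heatKernel d κ p.1 p.2 := by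
  unfold heatKernel; fun_prop

lemma lintegral_heatKernel (d : ℕ) {κ s : ℝ} (hκ : 0 < κ) (hs : 0 < s) :
    ∫⁻ y : EuclideanSpace ℝ (Fin d), ENNReal.ofReal (heatKernel d κ s y) = 1 := by
  have hq : 0 < 2 * π * κ * s := by positivity
  have hb : 0 < 1 / (2 * κ * s) := by positivity
  simp only [heatKernel, ENNReal.ofReal_mul (rpow_nonneg hq.le _)]
  rw [lintegral_const_mul' _ _ ENNReal.ofReal_ne_top]
  have h := lintegral_exp_neg_mul_sq_norm d hb
  simp only [show ∀ x : ℝ, -(1 / (2 * κ * s)) * x = -x / (2 * κ * s) by intro x; ring] at h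
  rw [h, ← ENNReal.ofReal_mul (rpow_nonneg hq.le _),
    show π / (1 / (2 * κ * s)) = 2 * π * κ * s by field_simp, ← rpow_add hq]
  simp [neg_div]

lemma lintegral_heatKernel_sq (d : ℕ) {κ s : ℝ} (hκ : 0 < κ) (hs : 0 < s) :
    ∫⁻ y : EuclideanSpace ℝ (Fin d), ENNReal.ofReal (heatKernel d κ s y ^ 2) =
      ENNReal.ofReal ((4 * π * κ) ^ (-(d : ℝ) / 2) * s ^ (-(d : ℝ) / 2)) := by
  have hq : 0 < 2 * π * κ * s := by positivity
  have hb : 0 < 1 / (κ * s) := by positivity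
  have hsq : ∀ y : EuclideanSpace ℝ (Fin d), heatKernel d κ s y ^ 2 =
      (2 * π * κ * s) ^ (-(d : ℝ)) * rexp (-(1 / (κ * s)) * ‖y‖ ^ 2) := by
    intro y
    rw [heatKernel, mul_pow, ← rpow_natCast, ← rpow_mul hq.le, ← exp_nat_mul]
    congr 2
    · push_cast; ring
    · push_cast; field_simp
  simp only [hsq, ENNReal.ofReal_mul (rpow_nonneg hq.le _)]
  rw [lintegral_const_mul' _ _ ENNReal.ofReal_ne_top, lintegral_exp_neg_mul_sq_norm d hb,
    ← ENNReal.ofReal_mul (rpow_nonneg hq.le _), ← mul_rpow (by positivity) hs.le]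
  congr 1
  rw [show 4 * π * κ * s = (2 * π * κ * s) ^ (2 : ℝ) * (π / (1 / (κ * s)))⁻¹ by
      rw [rpow_two]; field_simp; norm_num,
    mul_rpow (x := (2 * π * κ * s) ^ (2 : ℝ)) (by positivity) (by positivity),
    ← rpow_mul hq.le, inv_rpow (by positivity),
    ← rpow_neg (by positivity)]
  congr 2 <;> ring

/-- The spatial integral `∫ min(1, g(s,y)² z²) dy`. -/
def spatialEnergy (d : ℕ) (κ s z : ℝ) : ℝ≥0∞ :=
  ∫⁻ y : EuclideanSpace ℝ (Fin d), ENNReal.ofReal (min 1 ((heatKernel d κ s y) ^ 2 * z ^ 2))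

lemma measurable_spatialEnergy (d : ℕ) (κ : ℝ) :
    Measurable fun p : ℝ × ℝ => spatialEnergy d κ p.1 p.2 := by
  have h : Measurable fun p : (ℝ × ℝ) × EuclideanSpace ℝ (Fin d) =>
      ENNReal.ofReal (min 1 ((heatKernel d κ p.1.1 p.2) ^ 2 * p.1.2 ^ 2)) := by
    have := (measurable_heatKernel d κ).comp
      (f := fun p : (ℝ × ℝ) × EuclideanSpace ℝ (Fin d) => (p.1.1, p.2)) (by fun_prop)
    simp only [Function.comp_def] at this
    fun_prop
  exact h.lintegral_prod_right'

lemma spatialEnergy_le_self (d : ℕ) {κ s z : ℝ} (hκ : 0 < κ) (hs : 0 < s) (hz : 0 ≤ z) :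
    spatialEnergy d κ s z ≤ ENNReal.ofReal z := by
  calc spatialEnergy d κ s z
      ≤ ∫⁻ y : EuclideanSpace ℝ (Fin d), ENNReal.ofReal (heatKernel d κ s y) *
          ENNReal.ofReal z := by
        refine lintegral_mono fun y => ?_
        have hu := heatKernel_nonneg d hκ hs y
        rw [← ENNReal.ofReal_mul hu, ← mul_pow]
        refine ENNReal.ofReal_le_ofReal ?_
        rcases le_total 1 (heatKernel d κ s y * z) with h | h
        · exact (min_le_left _ _).trans h
        · exact (min_le_right _ _).trans (pow_le_of_le_one (by positivity) h two_ne_zero)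
    _ = ENNReal.ofReal z := by
        rw [lintegral_mul_const' _ _ ENNReal.ofReal_ne_top, lintegral_heatKernel d hκ hs, one_mul]

lemma lintegral_heatKernel_sq_mul (d : ℕ) {κ s : ℝ} (hκ : 0 < κ) (hs : 0 < s) (z : ℝ) :
    ∫⁻ y : EuclideanSpace ℝ (Fin d), ENNReal.ofReal (heatKernel d κ s y ^ 2 * z ^ 2) =
      ENNReal.ofReal ((4 * π * κ) ^ (-(d : ℝ) / 2) * z ^ 2) *
        ENNReal.ofReal (s ^ (-(d : ℝ) / 2)) := by
  simp only [ENNReal.ofReal_mul (sq_nonneg _)]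
  rw [lintegral_mul_const' _ _ ENNReal.ofReal_ne_top, lintegral_heatKernel_sq d hκ hs,
    ← ENNReal.ofReal_mul (by positivity), ← ENNReal.ofReal_mul (by positivity)]
  congr 1; ring

lemma spatialEnergy_le_sq (d : ℕ) {κ s : ℝ} (hκ : 0 < κ) (hs : 0 < s) (z : ℝ) :
    spatialEnergy d κ s z ≤ ENNReal.ofReal ((4 * π * κ) ^ (-(d : ℝ) / 2) * z ^ 2) *
      ENNReal.ofReal (s ^ (-(d : ℝ) / 2)) := by
  rw [← lintegral_heatKernel_sq_mul d hκ hs]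
  exact lintegral_mono fun y => ENNReal.ofReal_le_ofReal (min_le_right _ _)

lemma spatialEnergy_eq_sq {d : ℕ} (hd : 1 ≤ d) {κ s z : ℝ} (hκ : 0 < κ) (hz : 0 < z)
    (hs : z ^ (2 / (d : ℝ)) / (2 * π * κ) ≤ s) :
    spatialEnergy d κ s z = ENNReal.ofReal ((4 * π * κ) ^ (-(d : ℝ) / 2) * z ^ 2) *
      ENNReal.ofReal (s ^ (-(d : ℝ) / 2)) := by
  have hs0 : 0 < s := lt_of_lt_of_le (by positivity) hs
  have hd0 : (0 : ℝ) < d := by exact_mod_cast hd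
  rw [← lintegral_heatKernel_sq_mul d hκ hs0]
  refine lintegral_congr fun y => ?_
  rw [min_eq_right]
  rw [← mul_pow]
  refine pow_le_one₀ (mul_nonneg (heatKernel_nonneg d hκ hs0 y) hz.le) ?_
  rw [div_le_iff₀ (by positivity)] at hs
  have hzle : z ≤ (2 * π * κ * s) ^ ((d : ℝ) / 2) := by
    calc z = (z ^ (2 / (d : ℝ))) ^ ((d : ℝ) / 2) := by
          rw [← rpow_mul hz.le, show 2 / (d : ℝ) * (d / 2) = 1 by field_simp, rpow_one]
      _ ≤ _ := rpow_le_rpow (by positivity) (by linarith) (by positivity)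
  calc heatKernel d κ s y * z
      ≤ (2 * π * κ * s) ^ (-(d : ℝ) / 2) * (2 * π * κ * s) ^ ((d : ℝ) / 2) :=
        mul_le_mul (heatKernel_le d hκ hs0 y) hzle hz.le (by positivity)
    _ = 1 := by
        rw [← rpow_add (by positivity)]; simp [neg_div]

lemma sFinite_of_lintegral_ne_top {α : Type*} [MeasurableSpace α] {μ : Measure α}
    {f : α → ℝ≥0∞} (hf : AEMeasurable f μ) (hpos : ∀ᵐ x ∂μ, f x ≠ 0)
    (hfin : ∫⁻ x, f x ∂μ ≠ ∞) : SFinite μ := by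
  have := isFiniteMeasure_withDensity hfin
  rw [← withDensity_inv_same₀ hf hpos ((ae_lt_top' hf hfin).mono fun _ h => h.ne)]
  infer_instance

lemma IsLevyMeasure.lintegral_sq_lt_top {lam : Measure ℝ} (h : IsLevyMeasure lam) :
    ∫⁻ z in Ioc (0 : ℝ) 1, ENNReal.ofReal (z ^ 2) ∂lam < ⊤ := by
  refine lt_of_le_of_lt ?_ h.2.2
  refine (setLIntegral_mono' measurableSet_Ioc fun z hz => ?_).trans
    (lintegral_mono_set Ioc_subset_Ioi_self)
  rw [min_eq_right (pow_le_one₀ hz.1.le hz.2)]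

lemma IsLevyMeasure.sFinite_restrict {lam : Measure ℝ} (h : IsLevyMeasure lam) :
    SFinite (lam.restrict (Ioc (0 : ℝ) 1)) := by
  refine sFinite_of_lintegral_ne_top (f := fun z : ℝ => ENNReal.ofReal (z ^ 2)) (by fun_prop) ?_
    h.lintegral_sq_lt_top.ne
  filter_upwards [ae_restrict_mem measurableSet_Ioc] with z hz
  have := pow_pos hz.1 2
  simpa using this.ne'

lemma lintegral_energy_swap (d : ℕ) (κ t : ℝ) (μ : Measure ℝ) [SFinite μ] :
    ∫⁻ s in Ioc (0 : ℝ) t, ∫⁻ y : EuclideanSpace ℝ (Fin d),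
      ∫⁻ z, ENNReal.ofReal (min 1 ((heatKernel d κ s y) ^ 2 * z ^ 2)) ∂μ =
    ∫⁻ z, ∫⁻ s in Ioc (0 : ℝ) t, spatialEnergy d κ s z ∂volume ∂μ := by
  rw [← lintegral_lintegral_swap (f := fun s z => spatialEnergy d κ s z)
    (measurable_spatialEnergy d κ).aemeasurable]
  refine lintegral_congr fun s => lintegral_lintegral_swap ?_
  have := (measurable_heatKernel d κ).comp
    (f := fun p : EuclideanSpace ℝ (Fin d) × ℝ => (s, p.1)) (by fun_prop)
  simp only [Function.comp_def] at this
  simp only [Function.uncurry_def]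
  fun_prop

lemma setLIntegral_lt_top_of_le_add {α : Type*} [MeasurableSpace α] {μ : Measure α} {S : Set α}
    (hS : MeasurableSet S) {f g h : α → ℝ≥0∞} {a b : ℝ≥0∞} (ha : a ≠ ∞) (hb : b ≠ ∞)
    (hle : ∀ x ∈ S, f x ≤ a * g x + b * h x) (hh : Measurable h)
    (hg : ∫⁻ x in S, g x ∂μ < ∞) (hhi : ∫⁻ x in S, h x ∂μ < ∞) :
    ∫⁻ x in S, f x ∂μ < ∞ := by
  refine (setLIntegral_mono' hS hle).trans_lt ?_
  rw [lintegral_add_right _ (hh.const_mul b), lintegral_const_mul' _ _ ha,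
    lintegral_const_mul' _ _ hb]
  exact ENNReal.add_lt_top.2
    ⟨ENNReal.mul_lt_top ha.lt_top hg, ENNReal.mul_lt_top hb.lt_top hhi⟩

lemma setLIntegral_spatialEnergy_le_sq (d : ℕ) {κ : ℝ} (hκ : 0 < κ) (z : ℝ) {S : Set ℝ}
    (hS : MeasurableSet S) (hS0 : S ⊆ Ioi 0) :
    ∫⁻ s in S, spatialEnergy d κ s z ≤ ENNReal.ofReal ((4 * π * κ) ^ (-(d : ℝ) / 2) * z ^ 2) *
      ∫⁻ s in S, ENNReal.ofReal (s ^ (-(d : ℝ) / 2)) := by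
  rw [← lintegral_const_mul' _ _ ENNReal.ofReal_ne_top]
  exact setLIntegral_mono' hS fun s hs => spatialEnergy_le_sq d hκ (hS0 hs) z

lemma setLIntegral_spatialEnergy_eq_sq {d : ℕ} (hd : 1 ≤ d) {κ z : ℝ} (hκ : 0 < κ) (hz : 0 < z)
    {S : Set ℝ} (hS : MeasurableSet S) (hSz : S ⊆ Ici (z ^ (2 / (d : ℝ)) / (2 * π * κ))) :
    ∫⁻ s in S, spatialEnergy d κ s z = ENNReal.ofReal ((4 * π * κ) ^ (-(d : ℝ) / 2) * z ^ 2) *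
      ∫⁻ s in S, ENNReal.ofReal (s ^ (-(d : ℝ) / 2)) := by
  rw [← lintegral_const_mul' _ _ ENNReal.ofReal_ne_top]
  exact setLIntegral_congr_fun hS fun s hs => spatialEnergy_eq_sq hd hκ hz (hSz hs)

lemma setLIntegral_Ioc_spatialEnergy_le (d : ℕ) {κ z : ℝ} (hκ : 0 < κ) (hz : 0 ≤ z) (r : ℝ) :
    ∫⁻ s in Ioc 0 r, spatialEnergy d κ s z ≤ ENNReal.ofReal (z * r) := by
  calc ∫⁻ s in Ioc 0 r, spatialEnergy d κ s z
      ≤ ∫⁻ _ in Ioc 0 r, ENNReal.ofReal z :=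
        setLIntegral_mono' measurableSet_Ioc fun s hs => spatialEnergy_le_self d hκ hs.1 hz
    _ = _ := by simp [ENNReal.ofReal_mul hz]

lemma energy_one_lt_top {κ : ℝ} (t : ℝ) (hκ : 0 < κ) {lam : Measure ℝ} (hlam : IsLevyMeasure lam) :
    ∫⁻ z in Ioc (0 : ℝ) 1, ∫⁻ s in Ioc (0 : ℝ) t, spatialEnergy 1 κ s z ∂volume ∂lam < ⊤ := by
  have hJ : ∫⁻ s in Ioc (0 : ℝ) t, ENNReal.ofReal (s ^ (-((1 : ℕ) : ℝ) / 2)) < ⊤ := by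
    have h : IntervalIntegrable (fun s : ℝ => s ^ (-((1 : ℕ) : ℝ) / 2)) volume 0 t :=
      intervalIntegral.intervalIntegrable_rpow' (by norm_num)
    exact h.1.lintegral_lt_top
  refine setLIntegral_lt_top_of_le_add (g := 0) (a := 0) measurableSet_Ioc ENNReal.zero_ne_top
    (ENNReal.mul_ne_top (ENNReal.ofReal_ne_top (r := (4 * π * κ) ^ (-((1 : ℕ) : ℝ) / 2))) hJ.ne)
    (fun z _ => ?_) (by fun_prop) (by simp) hlam.lintegral_sq_lt_top
  refine (setLIntegral_spatialEnergy_le_sq 1 hκ z measurableSet_Ioc Ioc_subset_Ioi_self).trans ?_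
  rw [ENNReal.ofReal_mul (by positivity), zero_mul, zero_add, mul_right_comm]

lemma setLIntegral_Ioc_inv {a b : ℝ} (ha : 0 < a) (hab : a ≤ b) :
    ∫⁻ s in Ioc a b, ENNReal.ofReal (s ^ (-((2 : ℕ) : ℝ) / 2)) =
      ENNReal.ofReal (log b - log a) := by
  have hb := ha.trans_le hab
  have hi : IntervalIntegrable (fun s : ℝ => s⁻¹) volume a b :=
    intervalIntegrable_inv_iff.2 (.inr (notMem_uIcc_of_lt ha hb))
  rw [← log_div hb.ne' ha.ne', ← integral_inv_of_pos ha hb,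
    intervalIntegral.integral_of_le hab, ofReal_integral_eq_lintegral_ofReal hi.1]
  · refine setLIntegral_congr_fun measurableSet_Ioc fun s _ => ?_
    norm_num [rpow_neg_one]
  · filter_upwards [ae_restrict_mem measurableSet_Ioc] with s hs
    exact inv_nonneg.2 (ha.trans hs.1).le

lemma energy_two_lt_top_iff {κ t : ℝ} (hκ : 0 < κ) (ht : 0 < t) {lam : Measure ℝ}
    (hlam : IsLevyMeasure lam) :
    ∫⁻ z in Ioc (0 : ℝ) 1, ∫⁻ s in Ioc (0 : ℝ) t, spatialEnergy 2 κ s z ∂volume ∂lam < ⊤ ↔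
      ∫⁻ z in Ioc (0 : ℝ) 1, ENNReal.ofReal (z ^ 2 * |log z|) ∂lam < ⊤ := by
  set K : ℝ := (4 * π * κ) ^ (-((2 : ℕ) : ℝ) / 2) with hK
  have hK0 : 0 < K := by positivity
  constructor
  · intro h
    refine setLIntegral_lt_top_of_le_add (a := ENNReal.ofReal K⁻¹)
      (b := ENNReal.ofReal |log t + log (2 * π * κ)|) measurableSet_Ioc
      ENNReal.ofReal_ne_top ENNReal.ofReal_ne_top (fun z hz => ?_) (by fun_prop) h
      hlam.lintegral_sq_lt_top
    have hz0 : 0 < z := hz.1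
    have hlz : |log z| = -log z := abs_of_nonpos (log_nonpos hz.1.le hz.2)
    have hc : 0 < z / (2 * π * κ) := by positivity
    have hlc : log (z / (2 * π * κ)) = log z - log (2 * π * κ) :=
      log_div hz0.ne' (by positivity)
    rcases le_total (z / (2 * π * κ)) t with hzt | hzt
    · have hF : ENNReal.ofReal (K * z ^ 2) * ENNReal.ofReal (log t - log (z / (2 * π * κ))) ≤
          ∫⁻ s in Ioc (0 : ℝ) t, spatialEnergy 2 κ s z := by
        rw [← setLIntegral_Ioc_inv hc hzt, hK, ← setLIntegral_spatialEnergy_eq_sq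
          one_le_two hκ hz0 measurableSet_Ioc]
        · exact lintegral_mono_set (Ioc_subset_Ioc_left hc.le)
        · norm_num
          exact Ioc_subset_Icc_self.trans Icc_subset_Ici_self
      have hL : 0 ≤ log t - log (z / (2 * π * κ)) := sub_nonneg.2 (log_le_log hc hzt)
      calc ENNReal.ofReal (z ^ 2 * |log z|)
          ≤ ENNReal.ofReal (K⁻¹ * ((K * z ^ 2) * (log t - log (z / (2 * π * κ)))) +
              |log t + log (2 * π * κ)| * z ^ 2) := by
            refine ENNReal.ofReal_le_ofReal ?_
            rw [← mul_assoc, inv_mul_cancel_left₀ hK0.ne', hlc, hlz]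
            nlinarith [neg_abs_le (log t + log (2 * π * κ)), sq_nonneg z]
        _ ≤ _ := by
            rw [ENNReal.ofReal_add (by positivity) (by positivity),
              ENNReal.ofReal_mul (by positivity), ENNReal.ofReal_mul (by positivity : 0 ≤ K * z ^ 2),
              ENNReal.ofReal_mul (abs_nonneg _)]
            gcongr
    · refine le_add_left ?_
      rw [← ENNReal.ofReal_mul (abs_nonneg _)]
      refine ENNReal.ofReal_le_ofReal ?_
      have := log_le_log ht hzt
      rw [mul_comm]
      refine mul_le_mul_of_nonneg_right ?_ (sq_nonneg z)
      rw [hlz]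
      linarith [neg_abs_le (log t + log (2 * π * κ))]
  · intro h
    refine setLIntegral_lt_top_of_le_add (a := ENNReal.ofReal K)
      (b := ENNReal.ofReal (1 + K * |log t|)) measurableSet_Ioc
      ENNReal.ofReal_ne_top ENNReal.ofReal_ne_top (fun z hz => ?_) (by fun_prop) h
      hlam.lintegral_sq_lt_top
    have hz0 : 0 < z := hz.1
    have hlz : |log z| = -log z := abs_of_nonpos (log_nonpos hz.1.le hz.2)
    have h1 := setLIntegral_Ioc_spatialEnergy_le 2 hκ hz0.le z
    rw [← ENNReal.ofReal_mul hK0.le, ← ENNReal.ofReal_mul (by positivity),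
      ← ENNReal.ofReal_add (by positivity) (by positivity)]
    rcases le_total z t with hzt | hzt
    · have h2 := setLIntegral_spatialEnergy_le_sq 2 hκ z (S := Ioc z t) measurableSet_Ioc
        (Ioc_subset_Ioi_self.trans (Ioi_subset_Ioi hz0.le))
      rw [setLIntegral_Ioc_inv hz0 hzt, ← ENNReal.ofReal_mul (by positivity)] at h2
      rw [← Ioc_union_Ioc_eq_Ioc hz0.le hzt]
      refine (lintegral_union_le _ _ _).trans ((add_le_add h1 h2).trans ?_)
      have := log_le_log hz0 hzt
      rw [← hK, ← ENNReal.ofReal_add (by positivity)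
        (mul_nonneg (by positivity) (sub_nonneg.2 this))]
      refine ENNReal.ofReal_le_ofReal ?_
      rw [hlz]
      nlinarith [mul_le_mul_of_nonneg_left (le_abs_self (log t)) (by positivity : 0 ≤ K * z ^ 2)]
    · refine (lintegral_mono_set (Ioc_subset_Ioc_right hzt)).trans (h1.trans ?_)
      refine ENNReal.ofReal_le_ofReal ?_
      have : 0 ≤ K * (z ^ 2 * |log z|) + K * |log t| * z ^ 2 := by positivity
      nlinarith

lemma setLIntegral_Ioi_rpow {a c : ℝ} (ha : a < -1) (hc : 0 < c) :
    ∫⁻ s in Ioi c, ENNReal.ofReal (s ^ a) = ENNReal.ofReal (-c ^ (a + 1) / (a + 1)) := by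
  rw [← integral_Ioi_rpow_of_lt ha hc,
    ofReal_integral_eq_lintegral_ofReal (integrableOn_Ioi_rpow_of_lt ha hc)]
  filter_upwards [ae_restrict_mem measurableSet_Ioi] with s hs
  exact rpow_nonneg (hc.trans hs).le _

lemma sq_mul_rpow_scale {d : ℕ} (hd : 1 ≤ d) {z : ℝ} (hz : 0 < z) :
    z ^ 2 * (z ^ (2 / (d : ℝ))) ^ (-(d : ℝ) / 2 + 1) = z ^ (1 + 2 / (d : ℝ)) := by
  have hd0 : (0 : ℝ) < d := by exact_mod_cast hd
  rw [← rpow_mul hz.le, ← rpow_two, ← rpow_add hz]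
  congr 1
  field_simp
  ring

lemma energy_lt_top_iff_of_three_le {d : ℕ} (hd : 3 ≤ d) {κ t : ℝ} (hκ : 0 < κ) (ht : 0 < t)
    {lam : Measure ℝ} (hlam : IsLevyMeasure lam) :
    ∫⁻ z in Ioc (0 : ℝ) 1, ∫⁻ s in Ioc (0 : ℝ) t, spatialEnergy d κ s z ∂volume ∂lam < ⊤ ↔
      ∫⁻ z in Ioc (0 : ℝ) 1, ENNReal.ofReal (z ^ (1 + 2 / (d : ℝ))) ∂lam < ⊤ := by
  have hd3 : (3 : ℝ) ≤ d := by exact_mod_cast hd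
  have hd1 : 1 ≤ d := by omega
  set K : ℝ := (4 * π * κ) ^ (-(d : ℝ) / 2) with hK
  have hK0 : 0 < K := by positivity
  constructor
  · intro h
    set c : ℝ := (2 * π * κ)⁻¹ with hc
    have hc0 : 0 < c := by positivity
    set M : ℝ := K * (c * (2 * c) ^ (-(d : ℝ) / 2)) with hM
    have hM0 : 0 < M := by positivity
    set z₀ : ℝ := (t / (2 * c)) ^ ((d : ℝ) / 2) with hz₀
    have hz₀0 : 0 < z₀ := by positivity
    refine setLIntegral_lt_top_of_le_add (a := ENNReal.ofReal M⁻¹)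
      (b := ENNReal.ofReal z₀⁻¹) measurableSet_Ioc
      ENNReal.ofReal_ne_top ENNReal.ofReal_ne_top (fun z hz => ?_) (by fun_prop) h
      hlam.lintegral_sq_lt_top
    have hz0 : 0 < z := hz.1
    set r : ℝ := z ^ (2 / (d : ℝ)) with hr
    have hr0 : 0 < r := by positivity
    rcases le_total (2 * c * r) t with hzt | hzt
    · refine le_add_right ?_
      have hF : ENNReal.ofReal (M * z ^ (1 + 2 / (d : ℝ))) ≤
          ∫⁻ s in Ioc (0 : ℝ) t, spatialEnergy d κ s z := by
        calc ENNReal.ofReal (M * z ^ (1 + 2 / (d : ℝ)))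
            = ENNReal.ofReal (K * z ^ 2) *
                ∫⁻ _ in Ioc (c * r) (2 * c * r),
                  ENNReal.ofReal ((2 * c * r) ^ (-(d : ℝ) / 2)) := by
              rw [setLIntegral_const, volume_Ioc, ← ENNReal.ofReal_mul (by positivity),
                ← ENNReal.ofReal_mul (by positivity), ← sq_mul_rpow_scale hd1 hz0, ← hr,
                rpow_add_one hr0.ne', mul_rpow (by positivity) hr0.le, hM]
              congr 1; ring
          _ ≤ ENNReal.ofReal (K * z ^ 2) *
                ∫⁻ s in Ioc (c * r) (2 * c * r), ENNReal.ofReal (s ^ (-(d : ℝ) / 2)) := by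
              refine mul_le_mul_right (setLIntegral_mono' measurableSet_Ioc fun s hs =>
                ENNReal.ofReal_le_ofReal ?_) _
              have hs0 : 0 < s := lt_trans (by positivity) hs.1
              exact rpow_le_rpow_of_nonpos hs0 hs.2 (by linarith)
          _ = ∫⁻ s in Ioc (c * r) (2 * c * r), spatialEnergy d κ s z := by
              refine (setLIntegral_spatialEnergy_eq_sq hd1 hκ hz0 measurableSet_Ioc ?_).symm
              intro s hs
              rw [mem_Ici, ← hr, div_eq_inv_mul]
              exact hs.1.le
          _ ≤ _ := lintegral_mono_set (Ioc_subset_Ioc (by positivity) hzt)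
      calc ENNReal.ofReal (z ^ (1 + 2 / (d : ℝ)))
          = ENNReal.ofReal M⁻¹ * ENNReal.ofReal (M * z ^ (1 + 2 / (d : ℝ))) := by
            rw [← ENNReal.ofReal_mul (by positivity), inv_mul_cancel_left₀ hM0.ne']
        _ ≤ _ := by gcongr
    · refine le_add_left ?_
      rw [← ENNReal.ofReal_mul (by positivity)]
      refine ENNReal.ofReal_le_ofReal ?_
      have hzz : z₀ ≤ z := by
        calc z₀ ≤ r ^ ((d : ℝ) / 2) := by
              refine rpow_le_rpow (by positivity) ?_ (by positivity)
              rw [div_le_iff₀ (by positivity)]; linarith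
          _ = z := by
              rw [hr, ← rpow_mul hz0.le, show 2 / (d : ℝ) * (d / 2) = 1 by field_simp, rpow_one]
      calc z ^ (1 + 2 / (d : ℝ)) ≤ z ^ (1 : ℝ) :=
            rpow_le_rpow_of_exponent_ge hz0 hz.2 (le_add_of_nonneg_right (by positivity))
        _ = z := rpow_one z
        _ ≤ z₀⁻¹ * z ^ 2 := by
            rw [← div_eq_inv_mul, le_div_iff₀ hz₀0]
            nlinarith
  · intro h
    have ha : -(d : ℝ) / 2 < -1 := by linarith
    set D : ℝ := (-(-(d : ℝ) / 2 + 1))⁻¹ with hD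
    have hD0 : 0 < D := inv_pos.2 (by linarith)
    refine setLIntegral_lt_top_of_le_add (a := ENNReal.ofReal (1 + K * D)) (b := 0)
      measurableSet_Ioc ENNReal.ofReal_ne_top ENNReal.zero_ne_top (fun z hz => ?_)
      (by fun_prop) h hlam.lintegral_sq_lt_top
    have hz0 : 0 < z := hz.1
    set r : ℝ := z ^ (2 / (d : ℝ)) with hr
    have hr0 : 0 < r := by positivity
    have h1 := setLIntegral_Ioc_spatialEnergy_le d hκ hz0.le r
    have h2 := setLIntegral_spatialEnergy_le_sq d hκ z (S := Ioi r) measurableSet_Ioi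
      (Ioi_subset_Ioi hr0.le)
    have hdiv : -r ^ (-(d : ℝ) / 2 + 1) / (-(d : ℝ) / 2 + 1) = D * r ^ (-(d : ℝ) / 2 + 1) := by
      rw [hD, inv_neg, neg_div, div_eq_inv_mul, neg_mul]
    rw [setLIntegral_Ioi_rpow ha hr0, ← ENNReal.ofReal_mul (by positivity), hdiv] at h2
    have hsub : Ioc 0 t ⊆ Ioc 0 r ∪ Ioi r := fun s hs => by
      rcases le_or_gt s r with h | h
      exacts [.inl ⟨hs.1, h⟩, .inr h]
    refine (lintegral_mono_set hsub).trans ((lintegral_union_le _ _ _).trans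
      ((add_le_add h1 h2).trans_eq ?_))
    rw [← hK, ← ENNReal.ofReal_add (by positivity) (by positivity), zero_mul, add_zero,
      ← ENNReal.ofReal_mul (by positivity)]
    congr 1
    have hz1 : z * r = z ^ (1 + 2 / (d : ℝ)) := by rw [rpow_add hz0, rpow_one]
    rw [hz1, add_mul, one_mul, ← sq_mul_rpow_scale hd1 hz0]
    ring

/-- Small-jump condition: with `I = ∫_0^t ∫_{ℝ^d} ∫_{(0,1]} min(1, g(s,y)²z²) λ(dz) dy ds`,
`I < ∞` always if `d = 1`; `I < ∞ ↔ ∫_{(0,1]} z²|log z| λ(dz) < ∞` if `d = 2`;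
`I < ∞ ↔ ∫_{(0,1]} z^{1+2/d} λ(dz) < ∞` if `d ≥ 3`. -/
theorem stmt_1 (d : ℕ) (hd : 1 ≤ d) (κ t : ℝ) (hκ : 0 < κ) (ht : 0 < t)
    (lam : Measure ℝ) (hlam : IsLevyMeasure lam)
    (I : ℝ≥0∞)
    (hI : I = ∫⁻ s in Set.Ioc (0 : ℝ) t, ∫⁻ y : EuclideanSpace ℝ (Fin d),
        ∫⁻ z in Set.Ioc (0 : ℝ) 1,
          ENNReal.ofReal (min 1 ((heatKernel d κ s y) ^ 2 * z ^ 2)) ∂lam) :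
    (d = 1 → I < ⊤) ∧
    (d = 2 → (I < ⊤ ↔
      ∫⁻ z in Set.Ioc (0 : ℝ) 1, ENNReal.ofReal (z ^ 2 * |Real.log z|) ∂lam < ⊤)) ∧
    (3 ≤ d → (I < ⊤ ↔
      ∫⁻ z in Set.Ioc (0 : ℝ) 1, ENNReal.ofReal (z ^ (1 + 2 / (d : ℝ))) ∂lam < ⊤)) := by
  have := hlam.sFinite_restrict
  rw [lintegral_energy_swap] at hI
  subst hI
  refine ⟨?_, ?_, fun h => energy_lt_top_iff_of_three_le h hκ ht hlam⟩
  · rintro rfl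
    exact energy_one_lt_top t hκ hlam
  · rintro rfl
    exact energy_two_lt_top_iff hκ ht hlam
end
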